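/- Fix integers ℓ ≥ 1, N_s ≥ 1, L = ℓN_s, parameters η, ξ₁,…,ξ_{N_s} ∈ ℂ with q = e^η satisfying q^{2m} ≠ 1 for 1 ≤ m ≤ ℓ, a weight function g : {0,…,ℓ} → ℂ∖{0}, and integers 1 ≤ i,j ≤ ℓ. Let μ₁,…,μ_N, λ₁,…,λ_M ∈ ℂ satisfy i − j = N − M and sinh(μ_α − w^{(ℓ)}_r + η) ≠ 0, sinh(λ_β − w^{(ℓ)}_r + η) ≠ 0 for all α, β, r. Define the projected operators B^{(ℓ+)}(λ) = P^{(ℓ)}_{1…L} B^{(ℓ+;0)}(λ) P^{(ℓ)}_{1…L} and C^{(ℓ+)}(μ) = P^{(ℓ)}_{1…L} C^{(ℓ+;0)}(μ) P^{(ℓ)}_{1…L}, the principal-grading operators B^{(ℓp;0)}(λ) = e^{λ} χ_{1…L}^{−1} B^{(ℓ+;0)}(λ) χ_{1…L} and C^{(ℓp;0)}(μ) = e^{−μ} χ_{1…L}^{−1} C^{(ℓ+;0)}(μ) χ_{1…L}, and the general elementary operator Ê₁^{i,j(ℓ+)} acting as (g(j)/g(i)) e^{(i−j)(ξ₁−(ℓ−1)η/2)}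 ||ℓ,i⟩⟨ℓ,j|| on the first block of ℓ factors and identity elsewhere. Then for every fixed A ⊆ {1,…,ℓ} with |A| = i: ⟨1_∅| ∏_{α=1}^{N} C^{(ℓ+)}(μ_α) · Ê₁^{i,j(ℓ+)} · ∏_{β=1}^{M} B^{(ℓ+)}(λ_β) |1_∅⟩ = N̂_{i,j} · e^{Σ_α μ_α − Σ_β λ_β} · Σ_{B⊆{1,…,ℓ}, |B|=j} ⟨1_∅| ∏_{α=1}^{N} C^{(ℓp;0)}(μ_α) · (|1_A⟩⟨1_B| on block 1) · ∏_{β=1}^{M} B^{(ℓp;0)}(λ_β) |1_∅⟩, where N̂_{i,j} = (g(j)/g(i)) (F(ℓ,i)/F(ℓ,j)) e^{η(i(ℓ−i) − j(ℓ−j))/2} with F(ℓ,n) = [ℓ choose n]_q q^{−n(ℓ−n)}. -/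

import Mathlib

noncomputable section

/-- The q-integer `[n]_q = (qⁿ − q⁻ⁿ)/(q − q⁻¹)`. -/
def qint (q : ℂ) (n : ℕ) : ℂ := (q ^ (n : ℤ) - q ^ (-(n : ℤ))) / (q - q⁻¹)

/-- The q-factorial `[n]_q! = ∏_{m=1}^n [m]_q`. -/
def qfact (q : ℂ) (n : ℕ) : ℂ := ∏ m ∈ Finset.range n, qint q (m + 1)

/-- The q-binomial coefficient `[l choose n]_q`. -/
def qbinom (q : ℂ) (l n : ℕ) : ℂ := qfact q l / (qfact q (l - n) * qfact q n)
/-- Index of the standard basis of `(ℂ²)^{⊗l}`: spin configurations `{0,1}^l`. -/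
abbrev SpinIdx (l : ℕ) := Fin l → Fin 2

/-- Vectors in `(ℂ²)^{⊗l}`. -/
abbrev SpinVec (l : ℕ) := SpinIdx l → ℂ

/-- Operators (matrices) on `(ℂ²)^{⊗l}`. -/
abbrev SpinOp (l : ℕ) := Matrix (SpinIdx l) (SpinIdx l) ℂ

/-- The indicator configuration of a subset `A`: down spins exactly on `A`. -/
def indFun {l : ℕ} (A : Finset (Fin l)) : SpinIdx l := fun k => if k ∈ A then 1 else 0

/-- The standard basis vector `|1_A⟩` with down spins exactly on `A`. -/
def bvec {l : ℕ} (A : Finset (Fin l)) : SpinVec l := fun ε => if ε = indFun A then 1 else 0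

/-- `Σ_{a ∈ A} a`, where the site `k : Fin l` has 1-based number `k+1 ∈ {1,…,l}`. -/
def siteSum {l : ℕ} (A : Finset (Fin l)) : ℤ := ∑ a ∈ A, ((a : ℤ) + 1)

/-- Coefficient `q^{(Σ_{a∈A} a) − i·l + i(i−1)/2}`. -/
def hwt (q : ℂ) {l : ℕ} (i : ℕ) (A : Finset (Fin l)) : ℂ :=
  q ^ (siteSum A - (i : ℤ) * (l : ℤ) + (i : ℤ) * ((i : ℤ) - 1) / 2)

/-- The spin-`l/2` basis vector `||l,i⟩`. -/
def hv (q : ℂ) (l i : ℕ) : SpinVec l :=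
  ∑ A ∈ Finset.powersetCard i (Finset.univ : Finset (Fin l)), hwt q i A • bvec A

/-- The conjugate covector `⟨l,j||` (represented by its coefficient vector; the pairing
is the bilinear transpose pairing). -/
def cv (q : ℂ) (l j : ℕ) : SpinVec l :=
  ((qbinom q l j)⁻¹ * q ^ ((j : ℤ) * ((l : ℤ) - (j : ℤ)))) •
    ∑ B ∈ Finset.powersetCard j (Finset.univ : Finset (Fin l)), hwt q j B • bvec B

/-- The rank-one operator `|u⟩⟨v|` (transpose pairing). -/
def rankOne {l : ℕ} (u v : SpinVec l) : SpinOp l := Matrix.of fun ε ε' => u ε * v ε'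

/-- The spin-`l/2` projector `P^{(l)} = Σ_{n=0}^{l} ||l,n⟩⟨l,n||`. -/
def proj (q : ℂ) (l : ℕ) : SpinOp l :=
  ∑ n ∈ Finset.range (l + 1), rankOne (hv q l n) (cv q l n)

/-- The elementary operator `e_k^{a,b}` acting on the k-th tensor factor. -/
def elem {l : ℕ} (k : Fin l) (a b : Fin 2) : SpinOp l :=
  Matrix.of fun ε ε' => if ε k = a ∧ ε' k = b ∧ ∀ m, m ≠ k → ε m = ε' m then 1 else 0

/-- The ordered product `e_1^{e'_1,e_1} ⋯ e_l^{e'_l,e_l}`. -/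
def elemProd {l : ℕ} (e' e : Fin l → Fin 2) : SpinOp l :=
  (List.ofFn fun k : Fin l => elem k (e' k) (e k)).prod

/-- The gauge matrix `⊗_s diag(1, e^{w s})`. -/
def gaugeM {S : Type*} [Fintype S] [DecidableEq S] (w : S → ℂ) :
    Matrix (S → Fin 2) (S → Fin 2) ℂ :=
  Matrix.diagonal fun ε => ∏ s, if ε s = 1 then Complex.exp (w s) else 1
/-- Sites of the chain of `Ns` blocks of `l` spin-1/2 sites: block `b`, position `β`
(1-based site number `l·b + β + 1`; lexicographic order is the site order). -/
abbrev FSite (l Ns : ℕ) := Fin Ns × Fin l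

/-- Spin configurations of the full chain `(ℂ²)^{⊗(l·Ns)}`. -/
abbrev FIdx2 (l Ns : ℕ) := FSite l Ns → Fin 2

/-- Operators on the full chain. -/
abbrev FOp (l Ns : ℕ) := Matrix (FIdx2 l Ns) (FIdx2 l Ns) ℂ

/-- Embed an operator on one block of `l` factors into the full chain (block `b`,
identity elsewhere). -/
def embed {l Ns : ℕ} (b : Fin Ns) (M : SpinOp l) : FOp l Ns :=
  Matrix.of fun ε ε' =>
    if ∀ s : FSite l Ns, s.1 ≠ b → ε s = ε' s then
      M (fun β => ε (b, β)) (fun β => ε' (b, β)) else 0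

/-- The complete `l`-string inhomogeneities `w^{(l)}_{l(b−1)+β} = ξ_b − (β−1)η`. -/
def wstring (l Ns : ℕ) (η : ℂ) (ξ : Fin Ns → ℂ) : FSite l Ns → ℂ :=
  fun s => ξ s.1 - (s.2.val : ℂ) * η

/-- The full projector `P^{(l)}_{1…L} = ⊗_{b=1}^{Ns} P^{(l)}` (one per block). -/
def projFull (q : ℂ) (l Ns : ℕ) : FOp l Ns :=
  Matrix.of fun ε ε' => ∏ b : Fin Ns, proj q l (fun β => ε (b, β)) (fun β => ε' (b, β))

/-- The normalization `F(l,n) = [l choose n]_q q^{−n(l−n)}`. -/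
def Fnorm (q : ℂ) (l n : ℕ) : ℂ := qbinom q l n * q ^ (-(n : ℤ) * ((l : ℤ) - (n : ℤ)))

/-- The normalization factor `N̂_{i,j} = (g(j)/g(i))·(F(l,i)/F(l,j))·e^{η(i(l−i)−j(l−j))/2}`. -/
def Nhat (q η : ℂ) (g : ℕ → ℂ) (l i j : ℕ) : ℂ :=
  (g j / g i) * (Fnorm q l i / Fnorm q l j) *
    Complex.exp (η * (((i : ℂ) * ((l : ℂ) - (i : ℂ)) - (j : ℂ) * ((l : ℂ) - (j : ℂ))) / 2))
/-- `b(u) = sinh u / sinh(u+η)`. -/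
def bC (η u : ℂ) : ℂ := Complex.sinh u / Complex.sinh (u + η)

/-- `c⁺(u) = e^{u} sinh η / sinh(u+η)`. -/
def cP (η u : ℂ) : ℂ := Complex.exp u * Complex.sinh η / Complex.sinh (u + η)

/-- `c⁻(u) = e^{−u} sinh η / sinh(u+η)`. -/
def cM (η u : ℂ) : ℂ := Complex.exp (-u) * Complex.sinh η / Complex.sinh (u + η)

/-- The homogeneous-grading R-matrix `R⁺(u)` on `ℂ² ⊗ ℂ²`: identity on `|00⟩`, `|11⟩`,
and `[[b, c⁻],[c⁺, b]]` on `span{|01⟩, |10⟩}`. -/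
def Rplus (η u : ℂ) : Matrix (Fin 2 × Fin 2) (Fin 2 × Fin 2) ℂ :=
  Matrix.of fun p p' =>
    if p = p' then (if p.1 = p.2 then 1 else bC η u)
    else if p.1 = 0 ∧ p.2 = 1 ∧ p'.1 = 1 ∧ p'.2 = 0 then cM η u
    else if p.1 = 1 ∧ p.2 = 0 ∧ p'.1 = 0 ∧ p'.2 = 1 then cP η u
    else 0

/-- The principal-grading (symmetric) R-matrix `R^p(u)`: identity on `|00⟩`, `|11⟩`,
and `[[b, c],[c, b]]` on `span{|01⟩, |10⟩}` with `c(u) = sinh η / sinh(u+η)`. -/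
def Rprin (η u : ℂ) : Matrix (Fin 2 × Fin 2) (Fin 2 × Fin 2) ℂ :=
  Matrix.of fun p p' =>
    if p = p' then (if p.1 = p.2 then 1 else bC η u)
    else if (p.1 = 0 ∧ p.2 = 1 ∧ p'.1 = 1 ∧ p'.2 = 0) ∨
            (p.1 = 1 ∧ p.2 = 0 ∧ p'.1 = 0 ∧ p'.2 = 1) then
      Complex.sinh η / Complex.sinh (u + η)
    else 0

/-- A 4×4 R-matrix acting on the pair (auxiliary space 0, quantum site j), identity on
the other sites. -/
def Rsite {S : Type*} [DecidableEq S] [Fintype S]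
    (R2 : Matrix (Fin 2 × Fin 2) (Fin 2 × Fin 2) ℂ) (j : S) :
    Matrix (Fin 2 × (S → Fin 2)) (Fin 2 × (S → Fin 2)) ℂ :=
  Matrix.of fun p p' =>
    if ∀ k, k ≠ j → p.2 k = p'.2 k then R2 (p.1, p.2 j) (p'.1, p'.2 j) else 0

/-- The monodromy matrix `T(λ) = R_{0,L}(λ−w_L) ⋯ R_{0,1}(λ−w_1)`, where `sites` lists
the sites `1,…,L` in increasing order. -/
def monodromy {S : Type*} [DecidableEq S] [Fintype S]
    (R2 : ℂ → Matrix (Fin 2 × Fin 2) (Fin 2 × Fin 2) ℂ)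
    (sites : List S) (w : S → ℂ) (lam : ℂ) :
    Matrix (Fin 2 × (S → Fin 2)) (Fin 2 × (S → Fin 2)) ℂ :=
  ((sites.map fun j => Rsite (R2 (lam - w j)) j).reverse).prod

/-- The auxiliary-space block entry of a monodromy matrix: `T_{a,b}` acting on the
quantum space (so `A = T_{0,0}`, `B = T_{0,1}`, `C = T_{1,0}`, `D = T_{1,1}`). -/
def entryT {S : Type*} (T : Matrix (Fin 2 × (S → Fin 2)) (Fin 2 × (S → Fin 2)) ℂ)
    (a b : Fin 2) : Matrix (S → Fin 2) (S → Fin 2) ℂ :=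
  Matrix.of fun ε ε' => T (a, ε) (b, ε')

/-- The number of down spins of a configuration. -/
def dcount {S : Type*} [Fintype S] [DecidableEq S] (ε : S → Fin 2) : ℕ :=
  (Finset.univ.filter fun s => ε s = 1).card

/-- The list of sites of the blocked chain in increasing (lexicographic) order. -/
def sitesList (l Ns : ℕ) : List (Fin Ns × Fin l) :=
  (List.finRange Ns).flatMap fun b => (List.finRange l).map fun β => (b, β)

/-- The homogeneous-grading monodromy matrix `T^{(ℓ+;0)}(λ)` of the blocked chain with
complete `ℓ`-string inhomogeneities. -/
def Tmon (l Ns : ℕ) (η : ℂ) (ξ : Fin Ns → ℂ) (lam : ℂ) :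
    Matrix (Fin 2 × FIdx2 l Ns) (Fin 2 × FIdx2 l Ns) ℂ :=
  monodromy (Rplus η) (sitesList l Ns) (wstring l Ns η ξ) lam

/-- `B^{(ℓ+;0)}(λ)`: the `(0,1)` entry of the monodromy matrix. -/
def Bop0 (l Ns : ℕ) (η : ℂ) (ξ : Fin Ns → ℂ) (lam : ℂ) : FOp l Ns :=
  entryT (Tmon l Ns η ξ lam) 0 1

/-- `C^{(ℓ+;0)}(μ)`: the `(1,0)` entry of the monodromy matrix. -/
def Cop0 (l Ns : ℕ) (η : ℂ) (ξ : Fin Ns → ℂ) (mu : ℂ) : FOp l Ns :=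
  entryT (Tmon l Ns η ξ mu) 1 0

/-- The projected operator `B^{(ℓ+)}(λ) = P^{(ℓ)}_{1…L} B^{(ℓ+;0)}(λ) P^{(ℓ)}_{1…L}`. -/
def Bproj (l Ns : ℕ) (η : ℂ) (ξ : Fin Ns → ℂ) (lam : ℂ) : FOp l Ns :=
  projFull (Complex.exp η) l Ns * Bop0 l Ns η ξ lam * projFull (Complex.exp η) l Ns

/-- The projected operator `C^{(ℓ+)}(μ) = P^{(ℓ)}_{1…L} C^{(ℓ+;0)}(μ) P^{(ℓ)}_{1…L}`. -/
def Cproj (l Ns : ℕ) (η : ℂ) (ξ : Fin Ns → ℂ) (mu : ℂ) : FOp l Ns :=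
  projFull (Complex.exp η) l Ns * Cop0 l Ns η ξ mu * projFull (Complex.exp η) l Ns

/-- The principal-grading operator `B^{(ℓp;0)}(λ) = e^{λ} χ_{1…L}^{−1} B^{(ℓ+;0)}(λ) χ_{1…L}`. -/
def Bprin (l Ns : ℕ) (η : ℂ) (ξ : Fin Ns → ℂ) (lam : ℂ) : FOp l Ns :=
  Complex.exp lam •
    ((gaugeM (wstring l Ns η ξ))⁻¹ * Bop0 l Ns η ξ lam * gaugeM (wstring l Ns η ξ))

/-- The principal-grading operator `C^{(ℓp;0)}(μ) = e^{−μ} χ_{1…L}^{−1} C^{(ℓ+;0)}(μ) χ_{1…L}`. -/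
def Cprin (l Ns : ℕ) (η : ℂ) (ξ : Fin Ns → ℂ) (mu : ℂ) : FOp l Ns :=
  Complex.exp (-mu) •
    ((gaugeM (wstring l Ns η ξ))⁻¹ * Cop0 l Ns η ξ mu * gaugeM (wstring l Ns η ξ))

/-- The all-up (vacuum) configuration of the full chain. -/
def vac (l Ns : ℕ) : FIdx2 l Ns := fun _ => 0


section helpers

open Matrix Function

lemma vecMul_Rsite {S : Type*} [DecidableEq S] [Fintype S]
    (R2 : Matrix (Fin 2 × Fin 2) (Fin 2 × Fin 2) ℂ) (j : S)
    (V : Fin 2 × (S → Fin 2) → ℂ) (a : Fin 2) (ε : S → Fin 2) :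
    (V ᵥ* Rsite R2 j) (a, ε)
      = ∑ a' : Fin 2, ∑ x : Fin 2, V (a', update ε j x) * R2 (a', x) (a, ε j) := by
  simp only [Matrix.vecMul, dotProduct, Fintype.sum_prod_type]
  refine Finset.sum_congr rfl fun a' _ => ?_
  symm
  refine Fintype.sum_of_injective (fun x : Fin 2 => update ε j x) ?_ _ _ ?_ ?_
  · intro x y h
    have := congrFun h j
    simpa using this
  · intro ε' hε'
    simp only [Rsite, Matrix.of_apply]
    rw [if_neg, mul_zero]
    intro h
    apply hε'
    refine ⟨ε' j, ?_⟩
    funext k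
    by_cases hk : k = j
    · subst hk; simp
    · simp [hk, h k hk]
  · intro x
    simp only [Rsite, Matrix.of_apply, update_self]
    rw [if_pos]
    intro k hk
    simp [hk]

lemma upd_comm {S : Type*} [DecidableEq S] {a b : S} (h : a ≠ b) (v w : Fin 2) (f : S → Fin 2) :
    update (update f a v) b w = update (update f b w) a v := update_comm h v w f

lemma upd_idem {S : Type*} [DecidableEq S] {a : S} (v w : Fin 2) (f : S → Fin 2) :
    update (update f a v) a w = update f a w := by
  simp

/-- Symmetry of a row vector (with auxiliary space) at an ordered pair of sites. -/
def SymAt {S : Type*} [DecidableEq S] (q : ℂ) (s t : S) (V : Fin 2 × (S → Fin 2) → ℂ) : Prop :=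
  ∀ a ε, ε s = 0 → ε t = 1 → V (a, ε) = q * V (a, update (update ε s 1) t 0)

lemma SymAt.other {S : Type*} [DecidableEq S] [Fintype S] {q : ℂ} {s t : S}
    {V : Fin 2 × (S → Fin 2) → ℂ} (h : SymAt q s t V) (j : S) (hs : j ≠ s) (ht : j ≠ t)
    (R2 : Matrix (Fin 2 × Fin 2) (Fin 2 × Fin 2) ℂ) : SymAt q s t (V ᵥ* Rsite R2 j) := by
  intro a ε h0 h1
  rw [vecMul_Rsite, vecMul_Rsite, Finset.mul_sum]
  refine Finset.sum_congr rfl fun a' _ => ?_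
  rw [Finset.mul_sum]
  refine Finset.sum_congr rfl fun x _ => ?_
  rw [h a' (update ε j x) (by simp [hs.symm, h0]) (by simp [ht.symm, h1])]
  rw [upd_comm hs x 1 ε, upd_comm ht x 0]
  simp only [update_of_ne hs, update_of_ne ht]
  ring

lemma SymAt.pair {S : Type*} [DecidableEq S] [Fintype S] {η : ℂ} {s t : S} (hst : s ≠ t)
    {V : Fin 2 × (S → Fin 2) → ℂ} (h : SymAt (Complex.exp η) s t V) (u : ℂ)
    (h1 : Complex.sinh (u + η) ≠ 0) (h2 : Complex.sinh (u + η + η) ≠ 0) :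
    SymAt (Complex.exp η) s t (V ᵥ* Rsite (Rplus η (u + η)) t ᵥ* Rsite (Rplus η u) s) := by
  intro a ε hs0 ht1
  have e1 : ∀ x y z w: Fin 2, update (update (update (update ε s x) t y) s z) t w
      = update (update ε s z) t w := by
    intro x y z w
    rw [upd_comm hst.symm y z, upd_idem, upd_idem]
  have hV : ∀ a', V (a', update (update ε s 0) t 1)
      = Complex.exp η * V (a', update (update ε s 1) t 0) := by
    intro a'
    have := h a' (update (update ε s 0) t 1) (by simp [hst]) (by simp)
    rw [this, e1]
  have e2 : ∀ z w: Fin 2, update (update ε s z) t w s = z := by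
    intro z w; simp [hst]
  have e3 : ∀ z : Fin 2, update ε s z t = 1 := by
    intro z; simp [hst.symm, ht1]
  have e4 : ∀ x y z : Fin 2, update (update (update ε s x) t y) s z t = y := by
    intro x y z; simp [hst.symm]
  simp only [vecMul_Rsite, Fin.sum_univ_two, e1, e2, e3, e4, hs0, hV]
  have E0 : Complex.exp η ≠ 0 := Complex.exp_ne_zero _
  have E1 : Complex.exp u ≠ 0 := Complex.exp_ne_zero _
  simp only [Complex.sinh, Complex.exp_add, Complex.exp_neg, neg_add] at h1 h2
  generalize hy : Complex.exp η = y at *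
  generalize hx : Complex.exp u = x at *
  have k1 : x ^ 2 * y ^ 2 - 1 ≠ 0 := by
    intro h0
    apply h1
    field_simp
    linear_combination h0
  have k2 : x ^ 2 * y ^ 4 - 1 ≠ 0 := by
    intro h0
    apply h2
    field_simp
    linear_combination h0
  have k2' : y ^ 4 * x ^ 2 - 1 ≠ 0 := by rwa [mul_comm]
  have k1' : y ^ 2 * x ^ 2 - 1 ≠ 0 := by rwa [mul_comm]
  fin_cases a
  all_goals
    simp [Rplus, bC, cP, cM]
    simp only [Complex.sinh, Complex.exp_add, Complex.exp_neg, neg_add, hx, hy]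
    clear h1 h2
    field_simp
    ring

end helpers
section helpers2

open Matrix Function

lemma SymAt.list {S : Type*} [DecidableEq S] [Fintype S] {q : ℂ} {s t : S}
    (R : S → Matrix (Fin 2 × Fin 2) (Fin 2 × Fin 2) ℂ) (L : List S) (hs : s ∉ L) (ht : t ∉ L) :
    ∀ V : Fin 2 × (S → Fin 2) → ℂ, SymAt q s t V →
      SymAt q s t (V ᵥ* ((L.map fun j => Rsite (R j) j).reverse).prod) := by
  induction L with
  | nil => intro V h; simpa using h
  | cons x L ih =>
    intro V h
    simp only [List.mem_cons, not_or] at hs ht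
    simp only [List.map_cons, List.reverse_cons, List.prod_append, List.prod_cons, List.prod_nil,
      mul_one, ← Matrix.vecMul_vecMul]
    exact (ih hs.2 ht.2 V h).other x (Ne.symm hs.1) (Ne.symm ht.1) _

lemma sitesList_split (l Ns : ℕ) (b : Fin Ns) (k k' : Fin l) (hk : k'.val = k.val + 1) :
    ∃ p r : List (Fin Ns × Fin l), sitesList l Ns = p ++ (b, k) :: (b, k') :: r ∧
      (b, k) ∉ p ∧ (b, k') ∉ p ∧ (b, k) ∉ r ∧ (b, k') ∉ r := by
  have hnd : (sitesList l Ns).Nodup :=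
    List.Nodup.product (List.nodup_finRange Ns) (List.nodup_finRange l)
  obtain ⟨p1, s1, h1⟩ := List.append_of_mem (List.mem_finRange b)
  have h2 : List.finRange l = (List.finRange l).take k ++ k :: k' :: (List.finRange l).drop (k + 2) := by
    conv_lhs => rw [← List.take_append_drop k.val (List.finRange l)]
    congr 1
    rw [List.drop_eq_getElem_cons (by simp), List.drop_eq_getElem_cons (by simp; omega)]
    simp only [List.getElem_finRange]
    exact congrArg₂ List.cons (by ext; simp) (congrArg₂ List.cons (by ext; simp [hk]) rfl)
  have h3 : ∃ p r : List (Fin Ns × Fin l), sitesList l Ns = p ++ (b, k) :: (b, k') :: r := by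
    refine ⟨(p1.flatMap fun b => (List.finRange l).map fun β => (b, β)) ++
      ((List.finRange l).take k).map (fun β => (b, β)),
      ((List.finRange l).drop (k + 2)).map (fun β => (b, β)) ++
      (s1.flatMap fun b => (List.finRange l).map fun β => (b, β)), ?_⟩
    unfold sitesList
    rw [h1]
    simp only [List.flatMap_append, List.flatMap_cons]
    rw [congrArg (List.map (fun β => (b, β))) h2]
    simp only [List.map_append, List.map_cons, List.append_assoc, List.cons_append]
  obtain ⟨p, r, h⟩ := h3
  refine ⟨p, r, h, ?_⟩
  rw [h] at hnd
  simp only [List.nodup_append, List.nodup_cons, List.mem_cons, not_or] at hnd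
  obtain ⟨-, ⟨h4, h5, -⟩, h6⟩ := hnd
  refine ⟨fun hm => h6 _ hm _ (Or.inl rfl) rfl, fun hm => h6 _ hm _ (Or.inr (Or.inl rfl)) rfl,
    h4.2, h5⟩

/-- `q`-symmetric row vectors of the full chain. -/
def SymV (q : ℂ) {l Ns : ℕ} (v : FIdx2 l Ns → ℂ) : Prop :=
  ∀ (b : Fin Ns) (k k' : Fin l), k'.val = k.val + 1 → ∀ ε : FIdx2 l Ns,
    ε (b, k) = 0 → ε (b, k') = 1 → v ε = q * v (update (update ε (b, k) 1) (b, k') 0)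

lemma SymV.entry {l Ns : ℕ} {η : ℂ} {v : FIdx2 l Ns → ℂ} (h : SymV (Complex.exp η) v)
    (ξ : Fin Ns → ℂ) (lam : ℂ)
    (hd : ∀ s : FSite l Ns, Complex.sinh (lam - wstring l Ns η ξ s + η) ≠ 0) (a c : Fin 2) :
    SymV (Complex.exp η) (v ᵥ* entryT (Tmon l Ns η ξ lam) a c) := by
  intro b k k' hk
  let V : Fin 2 × FIdx2 l Ns → ℂ := fun p => if p.1 = a then v p.2 else 0
  have hV : SymAt (Complex.exp η) (b, k) (b, k') V := by
    intro a' ε h0 h1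
    simp only [V]
    split_ifs
    · exact h b k k' hk ε h0 h1
    · simp
  have hVT : ∀ ε, (v ᵥ* entryT (Tmon l Ns η ξ lam) a c) ε = (V ᵥ* Tmon l Ns η ξ lam) (c, ε) := by
    intro ε
    simp [Matrix.vecMul, dotProduct, Fintype.sum_prod_type, V, entryT, ite_mul]
  have key : SymAt (Complex.exp η) (b, k) (b, k') (V ᵥ* Tmon l Ns η ξ lam) := by
    obtain ⟨p, r, hL, n1, n2, n3, n4⟩ := sitesList_split l Ns b k k' hk
    unfold Tmon monodromy
    rw [hL]
    simp only [List.map_append, List.map_cons, List.reverse_append, List.reverse_cons,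
      List.prod_append, List.prod_cons, List.prod_nil, mul_one, ← Matrix.vecMul_vecMul]
    refine SymAt.list (fun j => Rplus η (lam - wstring l Ns η ξ j)) p n1 n2 _ ?_
    have hw : lam - wstring l Ns η ξ (b, k') = lam - wstring l Ns η ξ (b, k) + η := by
      simp only [wstring, hk]; push_cast; ring
    rw [hw]
    have hne : ((b, k) : Fin Ns × Fin l) ≠ (b, k') := by
      intro h; have := congrArg (fun x => x.2.val) h; simp at this; omega
    refine SymAt.pair hne ?_ _ (hd _) (by rw [← hw]; exact hd _)
    exact SymAt.list (fun j => Rplus η (lam - wstring l Ns η ξ j)) r n3 n4 _ hV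
  intro ε h0 h1
  rw [hVT, hVT]
  exact key c ε h0 h1

/-- generating sum for the norms. -/
lemma gsum (q : ℂ) (hq : q ≠ 0) (l : ℕ) : ∀ i, i ≤ l →
    (∑ A ∈ Finset.powersetCard i (Finset.range l), ∏ a ∈ A, q ^ (2 * ((a : ℤ) + 1)))
      * (qfact q (l - i) * qfact q i) = qfact q l * q ^ ((i : ℤ) * ((l : ℤ) + 1)) := by
  induction l with
  | zero => intro i hi; obtain rfl : i = 0 := by omega
            simp [qfact]
  | succ l ih =>
    intro i hi
    rcases i with _ | i
    · simp [qfact]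
    rw [Finset.range_add_one, Finset.powersetCard_succ_insert (by simp), Finset.sum_union]
    · rw [Finset.sum_image]
      · have hprod : ∀ A ∈ Finset.powersetCard i (Finset.range l),
            (∏ a ∈ insert l A, q ^ (2 * ((a : ℤ) + 1)))
              = q ^ (2 * ((l : ℤ) + 1)) * ∏ a ∈ A, q ^ (2 * ((a : ℤ) + 1)) := by
          intro A hA
          rw [Finset.prod_insert]
          intro hl
          have := (Finset.mem_powersetCard.1 hA).1 hl
          simp at this
        rw [Finset.sum_congr rfl hprod, ← Finset.mul_sum]
        have ih1 := ih i (by omega)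
        have hid : qint q (l - i) + q ^ ((l : ℤ) + 1) * qint q (i + 1)
            = qint q (l + 1) * q ^ ((i : ℤ) + 1) := by
          unfold qint
          rw [Nat.cast_sub (by omega : i ≤ l)]
          rw [mul_div_assoc', ← add_div, div_mul_eq_mul_div]
          congr 1
          push_cast
          simp only [mul_sub, sub_mul, ← zpow_add₀ hq]
          ring_nf
        have hfi : qfact q (i + 1) = qfact q i * qint q (i + 1) := Finset.prod_range_succ _ _
        have hfl : qfact q (l + 1) = qfact q l * qint q (l + 1) := Finset.prod_range_succ _ _
        have h2 : (∑ A ∈ Finset.powersetCard (i + 1) (Finset.range l),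
              ∏ a ∈ A, q ^ (2 * ((a : ℤ) + 1))) * (qfact q (l - i) * qfact q (i + 1))
            = qfact q l * q ^ (((i : ℤ) + 1) * ((l : ℤ) + 1)) * qint q (l - i) := by
          rcases Nat.lt_or_ge i l with h | h
          · have := ih (i + 1) (by omega)
            have hli : qfact q (l - i) = qfact q (l - (i + 1)) * qint q (l - i) := by
              obtain ⟨m, hm⟩ : ∃ m, l - i = m + 1 := ⟨l - i - 1, by omega⟩
              have hm' : l - (i + 1) = m := by omega
              rw [hm, hm']
              exact Finset.prod_range_succ _ _
            rw [hli]
            push_cast at this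
            linear_combination qint q (l - i) * this
          · obtain rfl : i = l := by omega
            rw [Finset.powersetCard_eq_empty.2 (by simp)]
            simp [qint]
        have hs : l + 1 - (i + 1) = l - i := by omega
        rw [hs, add_mul, h2, hfl]
        rw [hfi]
        have e1 : q ^ (((i + 1 : ℕ) : ℤ) * (((l + 1 : ℕ) : ℤ) + 1))
            = q ^ (((i : ℤ) + 1) * ((l : ℤ) + 1)) * q ^ ((i : ℤ) + 1) := by
          rw [← zpow_add₀ hq]; push_cast; ring_nf
        have e2 : q ^ (2 * ((l : ℤ) + 1)) * q ^ ((i : ℤ) * ((l : ℤ) + 1))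
            = q ^ (((i : ℤ) + 1) * ((l : ℤ) + 1)) * q ^ ((l : ℤ) + 1) := by
          rw [← zpow_add₀ hq, ← zpow_add₀ hq]; ring_nf
        rw [e1]
        linear_combination (q ^ (2 * ((l : ℤ) + 1)) * qint q (i + 1)) * ih1
          + qfact q l * qint q (i + 1) * e2
          + qfact q l * q ^ (((i : ℤ) + 1) * ((l : ℤ) + 1)) * hid
      · intro A hA B hB hAB
        have hA' : l ∉ A := fun h => by
          have := (Finset.mem_powersetCard.1 hA).1 h
          simp at this
        have hB' : l ∉ B := fun h => by
          have := (Finset.mem_powersetCard.1 hB).1 h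
          simp at this
        rw [← Finset.erase_insert hA', ← Finset.erase_insert hB', hAB]
    · rw [Finset.disjoint_left]
      intro A hA hA'
      obtain ⟨B, hB, rfl⟩ := Finset.mem_image.1 hA'
      have := (Finset.mem_powersetCard.1 hA).1 (Finset.mem_insert_self l B)
      simp at this

lemma qfact_ne {q : ℂ} (hq : q ≠ 0) {l : ℕ} (hroot : ∀ m : ℕ, 1 ≤ m → m ≤ l → q ^ (2 * m) ≠ 1)
    (n : ℕ) (hn : n ≤ l) : qfact q n ≠ 0 := by
  unfold qfact
  rw [Finset.prod_ne_zero_iff]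
  intro m hm
  rw [Finset.mem_range] at hm
  have aux : ∀ m : ℕ, 1 ≤ m → m ≤ l → q ^ (m : ℤ) - q ^ (-(m : ℤ)) ≠ 0 := by
    intro m h1 h2 h
    apply hroot m h1 h2
    rw [sub_eq_zero] at h
    rw [two_mul, pow_add]
    rw [_root_.zpow_neg, zpow_natCast] at h
    have := pow_ne_zero m hq
    field_simp at h
    rw [← h]; ring
  unfold qint
  apply div_ne_zero (aux _ (by omega) (by omega))
  have := aux 1 le_rfl (by omega)
  simpa using this

lemma hwt_sq_sum {q : ℂ} (hq : q ≠ 0) {l : ℕ}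
    (hroot : ∀ m : ℕ, 1 ≤ m → m ≤ l → q ^ (2 * m) ≠ 1) (i : ℕ) (hi : i ≤ l) :
    ∑ A ∈ Finset.powersetCard i (Finset.univ : Finset (Fin l)), hwt q i A * hwt q i A
      = Fnorm q l i := by
  have h1 := gsum q hq l i hi
  rw [← Nat.Iio_eq_range, ← Fin.map_valEmbedding_univ, Finset.powersetCard_map, Finset.sum_map] at h1
  have hF := qfact_ne hq hroot i hi
  have hF' := qfact_ne hq hroot (l - i) (by omega)
  unfold Fnorm qbinom
  have h2 : ∀ A ∈ Finset.powersetCard i (Finset.univ : Finset (Fin l)),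
      hwt q i A * hwt q i A = q ^ (-2 * (i : ℤ) * l + i * (i - 1)) *
        ∏ a ∈ (Finset.mapEmbedding Fin.valEmbedding A : Finset ℕ), q ^ (2 * ((a : ℤ) + 1)) := by
    intro A hA
    have hp : ∏ a ∈ (Finset.mapEmbedding Fin.valEmbedding A : Finset ℕ), q ^ (2 * ((a : ℤ) + 1))
        = q ^ (2 * siteSum A) := by
      rw [Finset.mapEmbedding_apply, Finset.prod_map]
      unfold siteSum
      rw [Finset.mul_sum]
      clear hA h1
      induction A using Finset.induction_on with
      | empty => simp
      | insert a s ha ih => rw [Finset.prod_insert ha, Finset.sum_insert ha, ih, zpow_add₀ hq]; rfl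
    rw [hp]
    unfold hwt
    rw [← zpow_add₀ hq, ← zpow_add₀ hq]
    congr 1
    have : (i : ℤ) * ((i : ℤ) - 1) / 2 * 2 = i * (i - 1) :=
      Int.ediv_mul_cancel (Int.even_mul_pred_self _).two_dvd
    linarith
  rw [Finset.sum_congr rfl h2, ← Finset.mul_sum]
  have e : q ^ (-(i : ℤ) * ((l : ℤ) - i)) = q ^ (-2 * (i : ℤ) * l + i * (i - 1)) * q ^ ((i : ℤ) * ((l : ℤ) + 1)) := by
    rw [← zpow_add₀ hq]; congr 1; ring
  rw [e, div_mul_eq_mul_div, eq_div_iff (mul_ne_zero hF' hF)]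
  linear_combination q ^ (-2 * (i : ℤ) * l + i * (i - 1)) * h1

lemma Fnorm_ne {q : ℂ} (hq : q ≠ 0) {l : ℕ}
    (hroot : ∀ m : ℕ, 1 ≤ m → m ≤ l → q ^ (2 * m) ≠ 1) (i : ℕ) (hi : i ≤ l) :
    Fnorm q l i ≠ 0 := by
  unfold Fnorm qbinom
  exact mul_ne_zero (div_ne_zero (qfact_ne hq hroot l le_rfl)
    (mul_ne_zero (qfact_ne hq hroot _ (by omega)) (qfact_ne hq hroot i hi))) (zpow_ne_zero _ hq)

end helpers2
section helpers3

open Matrix Function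

/-- support of a configuration -/
def supp {l : ℕ} (σ : SpinIdx l) : Finset (Fin l) := Finset.univ.filter fun k => σ k = 1

lemma supp_indFun {l : ℕ} (A : Finset (Fin l)) : supp (indFun A) = A := by
  ext k; simp [supp, indFun]

lemma fin2_ne {x : Fin 2} (h : x ≠ 1) : x = 0 := by omega

lemma indFun_supp {l : ℕ} (σ : SpinIdx l) : indFun (supp σ) = σ := by
  funext k
  by_cases h : σ k = 1
  · simp [supp, indFun, h]
  · simp [supp, indFun, fin2_ne h]

lemma dcount_supp {l : ℕ} (σ : SpinIdx l) : dcount σ = (supp σ).card := rfl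

lemma dcount_le {l : ℕ} (σ : SpinIdx l) : dcount σ ≤ l := by
  rw [dcount_supp]; simpa using Finset.card_le_univ (supp σ)

lemma hv_apply (q : ℂ) (l i : ℕ) (σ : SpinIdx l) :
    hv q l i σ = if dcount σ = i then hwt q i (supp σ) else 0 := by
  have h : ∀ A : Finset (Fin l), σ = indFun A ↔ A = supp σ := by
    intro A
    constructor
    · rintro rfl; exact (supp_indFun A).symm
    · rintro rfl; exact (indFun_supp σ).symm
  simp [hv, bvec, Finset.sum_apply, h, Finset.mem_powersetCard, dcount_supp]
  congr

lemma hv_indFun (q : ℂ) (l i : ℕ) (A : Finset (Fin l)) :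
    hv q l i (indFun A) = if A.card = i then hwt q i A else 0 := by
  rw [hv_apply, dcount_supp, supp_indFun]

lemma cv_apply (q : ℂ) (l j : ℕ) (σ : SpinIdx l) :
    cv q l j σ = (Fnorm q l j)⁻¹ * hv q l j σ := by
  have : cv q l j = ((qbinom q l j)⁻¹ * q ^ ((j : ℤ) * ((l : ℤ) - (j : ℤ)))) • hv q l j := rfl
  rw [this, Pi.smul_apply, smul_eq_mul, Fnorm, mul_inv, neg_mul, _root_.zpow_neg, inv_inv]

lemma sum_hv (q : ℂ) (l i : ℕ) (f : SpinIdx l → ℂ) :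
    ∑ σ, f σ * hv q l i σ
      = ∑ A ∈ Finset.powersetCard i (Finset.univ : Finset (Fin l)), f (indFun A) * hwt q i A := by
  simp only [hv, bvec, Finset.sum_apply, Pi.smul_apply, smul_eq_mul, Finset.mul_sum]
  rw [Finset.sum_comm]
  simp

/-- the weight of a block configuration -/
def bw (q : ℂ) {l : ℕ} (σ : SpinIdx l) : ℂ := hwt q (dcount σ) (supp σ)

lemma bw_ne {q : ℂ} (hq : q ≠ 0) {l : ℕ} (σ : SpinIdx l) : bw q σ ≠ 0 := zpow_ne_zero _ hq

lemma hv_bw (q : ℂ) (l i : ℕ) (σ : SpinIdx l) :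
    hv q l i σ = if dcount σ = i then bw q σ else 0 := by
  rw [hv_apply]
  split_ifs with h
  · rw [bw, h]
  · rfl

lemma sum_bw_sq {q : ℂ} (hq : q ≠ 0) {l : ℕ}
    (hroot : ∀ m : ℕ, 1 ≤ m → m ≤ l → q ^ (2 * m) ≠ 1) (i : ℕ) (hi : i ≤ l) :
    (∑ σ : SpinIdx l, if dcount σ = i then bw q σ * bw q σ else 0) = Fnorm q l i := by
  rw [← hwt_sq_sum hq hroot i hi]
  have : ∀ σ : SpinIdx l, (if dcount σ = i then bw q σ * bw q σ else 0)
      = hv q l i σ * hv q l i σ := by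
    intro σ; rw [hv_bw]; split_ifs <;> simp
  rw [Finset.sum_congr rfl fun σ _ => this σ, sum_hv]
  refine Finset.sum_congr rfl fun A hA => ?_
  rw [hv_indFun, if_pos (Finset.mem_powersetCard.1 hA).2]

lemma proj_apply (q : ℂ) (l : ℕ) (σ σ' : SpinIdx l) :
    proj q l σ σ' = if dcount σ = dcount σ' then
      bw q σ * bw q σ' * (Fnorm q l (dcount σ'))⁻¹ else 0 := by
  simp only [proj, Matrix.sum_apply, rankOne, Matrix.of_apply, cv_apply, hv_bw]
  rw [Finset.sum_eq_single (dcount σ')]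
  · rw [if_pos (rfl : dcount σ' = dcount σ')]
    split_ifs
    · ring
    · simp
  · intro n _ hn
    rw [if_neg hn.symm]; simp
  · intro h
    exact absurd (Finset.mem_range.2 (Nat.lt_succ_of_le (dcount_le σ'))) h

/-- block of a configuration -/
def blk {l Ns : ℕ} (b : Fin Ns) (ε : FIdx2 l Ns) : SpinIdx l := fun β => ε (b, β)

/-- full weight -/
def fw (q : ℂ) {l Ns : ℕ} (ε : FIdx2 l Ns) : ℂ := ∏ b, bw q (blk b ε)

lemma fw_ne {q : ℂ} (hq : q ≠ 0) {l Ns : ℕ} (ε : FIdx2 l Ns) : fw q ε ≠ 0 :=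
  Finset.prod_ne_zero_iff.2 fun _ _ => bw_ne hq _

lemma supp_swap {l : ℕ} (k k' : Fin l) (hk : k ≠ k') (σ : SpinIdx l)
    (h1 : σ k' = 1) : supp (update (update σ k 1) k' 0) = insert k ((supp σ).erase k') := by
  ext x
  by_cases hx : x = k'
  · subst hx; simp [supp, hk.symm]
  · by_cases hx' : x = k
    · subst hx'; simp [supp, hx]
    · simp [supp, hx, hx']

lemma dcount_swap {l : ℕ} (k k' : Fin l) (hk : k ≠ k') (σ : SpinIdx l)
    (h0 : σ k = 0) (h1 : σ k' = 1) : dcount (update (update σ k 1) k' 0) = dcount σ := by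
  rw [dcount_supp, dcount_supp, supp_swap k k' hk σ h1, Finset.card_insert_of_notMem,
    Finset.card_erase_add_one]
  · simp [supp, h1]
  · simp [supp, h0]

lemma bw_swap {q : ℂ} (hq : q ≠ 0) {l : ℕ} (k k' : Fin l) (hk : k'.val = k.val + 1) (σ : SpinIdx l)
    (h0 : σ k = 0) (h1 : σ k' = 1) : bw q σ = q * bw q (update (update σ k 1) k' 0) := by
  have hne : k ≠ k' := by intro h; rw [h] at hk; omega
  have hs : siteSum (supp σ) = 1 + siteSum (supp (update (update σ k 1) k' 0)) := by
    rw [supp_swap k k' hne σ h1]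
    unfold siteSum
    rw [Finset.sum_insert (by simp [supp, h0]),
      ← Finset.add_sum_erase (supp σ) _ (show k' ∈ supp σ by simp [supp, h1]), hk]
    push_cast; ring
  unfold bw hwt
  rw [dcount_swap k k' hne σ h0 h1, hs]
  rw [← zpow_one_add₀ hq]
  congr 1; ring

lemma blk_update_same {l Ns : ℕ} (b : Fin Ns) (k : Fin l) (x : Fin 2) (ε : FIdx2 l Ns) :
    blk b (update ε (b, k) x) = update (blk b ε) k x := by
  funext β
  by_cases h : β = k
  · subst h; simp [blk]
  · simp [blk, h]

lemma blk_update_ne {l Ns : ℕ} {b b' : Fin Ns} (h : b' ≠ b) (k : Fin l) (x : Fin 2)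
    (ε : FIdx2 l Ns) : blk b' (update ε (b, k) x) = blk b' ε := by
  funext β
  simp [blk, h]

lemma fw_swap {q : ℂ} (hq : q ≠ 0) {l Ns : ℕ} (b : Fin Ns) (k k' : Fin l)
    (hk : k'.val = k.val + 1) (ε : FIdx2 l Ns) (h0 : ε (b, k) = 0) (h1 : ε (b, k') = 1) :
    fw q ε = q * fw q (update (update ε (b, k) 1) (b, k') 0) := by
  unfold fw
  have hne : k ≠ k' := by intro h; rw [h] at hk; omega
  rw [← Finset.mul_prod_erase _ _ (Finset.mem_univ b),
    ← Finset.mul_prod_erase _ (fun b' => bw q (blk b' (update (update ε (b, k) 1) (b, k') 0)))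
      (Finset.mem_univ b)]
  rw [bw_swap hq k k' hk (blk b ε) h0 h1, blk_update_same, blk_update_same, mul_assoc]
  congr 2
  refine Finset.prod_congr rfl fun b' hb' => ?_
  have hb : b' ≠ b := Finset.ne_of_mem_erase hb'
  rw [blk_update_ne hb, blk_update_ne hb]

/-- action of block permutations -/
def bact {l Ns : ℕ} (τ : Fin Ns → Equiv.Perm (Fin l)) (ε : FIdx2 l Ns) : FIdx2 l Ns :=
  fun s => ε (s.1, τ s.1 s.2)

lemma bact_swap {l Ns : ℕ} (b : Fin Ns) (k k' : Fin l) (ε : FIdx2 l Ns) :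
    bact (Pi.mulSingle b (Equiv.swap k k')) ε
      = update (update ε (b, k) (ε (b, k'))) (b, k') (ε (b, k)) := by
  funext ⟨b', β⟩
  by_cases hb : b' = b
  · subst hb
    simp only [bact, Pi.mulSingle_eq_same]
    by_cases h' : β = k'
    · subst h'; simp
    · by_cases h : β = k
      · subst h; simp [h']
      · rw [Equiv.swap_apply_of_ne_of_ne h h']; simp [h, h']
  · simp [bact, hb]

lemma SymV.inv_swap {q : ℂ} (hq : q ≠ 0) {l Ns : ℕ} {v : FIdx2 l Ns → ℂ} (h : SymV q v)
    (b : Fin Ns) (k k' : Fin l) (hk : k'.val = k.val + 1) (ε : FIdx2 l Ns) :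
    v (bact (Pi.mulSingle b (Equiv.swap k k')) ε) *
        (fw q (bact (Pi.mulSingle b (Equiv.swap k k')) ε))⁻¹ = v ε * (fw q ε)⁻¹ := by
  have hne : ((b, k) : FSite l Ns) ≠ (b, k') := by
    intro h; have := congrArg (fun x => x.2.val) h; simp at this; omega
  have key : ∀ ε : FIdx2 l Ns, ε (b, k) = 0 → ε (b, k') = 1 →
      v ε * (fw q ε)⁻¹ = v (update (update ε (b, k) 1) (b, k') 0) *
        (fw q (update (update ε (b, k) 1) (b, k') 0))⁻¹ := by
    intro ε h0 h1
    rw [h b k k' hk ε h0 h1, fw_swap hq b k k' hk ε h0 h1]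
    rw [mul_inv]
    field_simp
  rw [bact_swap]
  by_cases h0 : ε (b, k) = 1
  · by_cases h1 : ε (b, k') = 1
    · have : update (update ε (b, k) (ε (b, k'))) (b, k') (ε (b, k)) = ε := by
        funext s
        by_cases hs : s = (b, k')
        · subst hs; simp [h0, h1]
        · by_cases hs' : s = (b, k)
          · subst hs'; simp [hs, h0, h1]
          · simp [hs, hs']
      rw [this]
    · have h1 := fin2_ne h1
      rw [h0, h1]
      rw [key (update (update ε (b, k) 0) (b, k') 1) (by simp [hne]) (by simp)]
      have : update (update (update (update ε (b, k) 0) (b, k') 1) (b, k) 1) (b, k') 0 = ε := by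
        funext s
        by_cases hs : s = (b, k')
        · subst hs; simp [h1]
        · by_cases hs' : s = (b, k)
          · subst hs'; simp [hs, h0]
          · simp [hs, hs']
      rw [this]
  · have h0 := fin2_ne h0
    by_cases h1 : ε (b, k') = 1
    · rw [h0, h1]
      exact (key ε h0 h1).symm
    · have h1 := fin2_ne h1
      have : update (update ε (b, k) (ε (b, k'))) (b, k') (ε (b, k)) = ε := by
        funext s
        by_cases hs : s = (b, k')
        · subst hs; simp [h0, h1]
        · by_cases hs' : s = (b, k)
          · subst hs'; simp [hs, h0, h1]
          · simp [hs, hs']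
      rw [this]

lemma SymV.inv_all {q : ℂ} (hq : q ≠ 0) {l Ns : ℕ} {v : FIdx2 l Ns → ℂ} (h : SymV q v)
    (τ : Fin Ns → Equiv.Perm (Fin l)) (ε : FIdx2 l Ns) :
    v (bact τ ε) * (fw q (bact τ ε))⁻¹ = v ε * (fw q ε)⁻¹ := by
  let J : Submonoid (Fin Ns → Equiv.Perm (Fin l)) :=
    { carrier := {τ | ∀ ε, v (bact τ ε) * (fw q (bact τ ε))⁻¹ = v ε * (fw q ε)⁻¹}
      one_mem' := fun ε => rfl
      mul_mem' := by
        intro τ τ' h1 h2 ε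
        have : bact (τ * τ') ε = bact τ' (bact τ ε) := rfl
        rw [this, h2, h1] }
  have h1 : ∀ (b : Fin Ns) (σ : Equiv.Perm (Fin l)), Pi.mulSingle b σ ∈ J := by
    intro b σ
    rcases l with _ | l
    · rw [Subsingleton.elim σ 1, Pi.mulSingle_one]; exact J.one_mem
    · have : (⊤ : Submonoid (Equiv.Perm (Fin (l + 1)))) ≤
          J.comap (MonoidHom.mulSingle (fun _ : Fin Ns => Equiv.Perm (Fin (l + 1))) b) := by
        rw [← Equiv.Perm.mclosure_swap_castSucc_succ, Submonoid.closure_le]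
        rintro _ ⟨i, rfl⟩
        exact fun ε => h.inv_swap hq b i.castSucc i.succ (by simp) ε
      exact this (Submonoid.mem_top σ)
  have h2 : τ ∈ J := Submonoid.pi_mem_of_mulSingle_mem τ fun b => h1 b (τ b)
  exact h2 ε

lemma exists_perm {l : ℕ} (σ σ' : SpinIdx l) (h : dcount σ = dcount σ') :
    ∃ τ : Equiv.Perm (Fin l), ∀ β, σ' (τ β) = σ β := by
  have hc : Fintype.card {x // σ x = 1} = Fintype.card {x // σ' x = 1} := by
    rw [Fintype.card_subtype, Fintype.card_subtype]; exact h
  let e := Fintype.equivOfCardEq hc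
  refine ⟨e.extendSubtype, fun β => ?_⟩
  by_cases hb : σ β = 1
  · rw [hb]; exact e.extendSubtype_mem β hb
  · rw [fin2_ne hb]; exact fin2_ne (e.extendSubtype_not_mem β hb)

lemma SymV.ratio {q : ℂ} (hq : q ≠ 0) {l Ns : ℕ} {v : FIdx2 l Ns → ℂ} (h : SymV q v)
    (ε ε' : FIdx2 l Ns) (hc : ∀ b, dcount (blk b ε) = dcount (blk b ε')) :
    v ε * (fw q ε)⁻¹ = v ε' * (fw q ε')⁻¹ := by
  choose τ hτ using fun b => exists_perm (blk b ε) (blk b ε') (hc b)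
  have : bact τ ε' = ε := by
    funext ⟨b, β⟩
    exact hτ b β
  rw [← h.inv_all hq τ ε', this]

lemma SymV.projFull {q : ℂ} (hq : q ≠ 0) {l Ns : ℕ}
    (hroot : ∀ m : ℕ, 1 ≤ m → m ≤ l → q ^ (2 * m) ≠ 1) {v : FIdx2 l Ns → ℂ} (h : SymV q v) :
    v ᵥ* projFull q l Ns = v := by
  funext ε
  have h1 : ∀ ε' : FIdx2 l Ns, v ε' * _root_.projFull q l Ns ε' ε
      = v ε * ∏ b, (if dcount (blk b ε') = dcount (blk b ε) then
          bw q (blk b ε') * bw q (blk b ε') else 0) * (Fnorm q l (dcount (blk b ε)))⁻¹ := by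
    intro ε'
    have hP : _root_.projFull q l Ns ε' ε = ∏ b, proj q l (blk b ε') (blk b ε) := rfl
    rw [hP]
    by_cases hc : ∀ b, dcount (blk b ε') = dcount (blk b ε)
    · have hr := h.ratio hq ε' ε hc
      have h3 := fw_ne hq ε
      have h4 := fw_ne hq ε'
      field_simp at hr
      simp only [proj_apply, hc, if_true, Finset.prod_mul_distrib]
      change v ε' * (fw q ε' * fw q ε * _) = v ε * (fw q ε' * fw q ε' * _)
      linear_combination (fw q ε' * ∏ b, (Fnorm q l (dcount (blk b ε)))⁻¹) * hr
    · push Not at hc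
      obtain ⟨b, hb⟩ := hc
      rw [Finset.prod_eq_zero (Finset.mem_univ b), Finset.prod_eq_zero (Finset.mem_univ b)]
      · simp
      · simp [hb]
      · simp [proj_apply, hb]
  simp only [Matrix.vecMul, dotProduct]
  rw [Finset.sum_congr rfl fun ε' _ => h1 ε', ← Finset.mul_sum]
  have h2 : ∑ ε' : FIdx2 l Ns, ∏ b, (if dcount (blk b ε') = dcount (blk b ε) then
          bw q (blk b ε') * bw q (blk b ε') else 0) * (Fnorm q l (dcount (blk b ε)))⁻¹ = 1 := by
    rw [← (Equiv.curry (Fin Ns) (Fin l) (Fin 2)).symm.sum_comp]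
    have := Finset.prod_univ_sum (fun _ : Fin Ns => (Finset.univ : Finset (SpinIdx l)))
      (fun b σ => (if dcount σ = dcount (blk b ε) then bw q σ * bw q σ else 0) *
        (Fnorm q l (dcount (blk b ε)))⁻¹)
    rw [Fintype.piFinset_univ] at this
    refine Eq.trans this.symm ?_
    refine Finset.prod_eq_one fun b _ => ?_
    rw [← Finset.sum_mul, sum_bw_sq hq hroot _ (dcount_le _)]
    exact mul_inv_cancel₀ (Fnorm_ne hq hroot _ (dcount_le _))
  rw [h2, mul_one]

end helpers3
section helpers4

open Matrix Function

/-- replace block `b` of `ε` by `σ` -/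
def comb {l Ns : ℕ} (b : Fin Ns) (σ : SpinIdx l) (ε : FIdx2 l Ns) : FIdx2 l Ns :=
  fun s => if s.1 = b then σ s.2 else ε s

lemma blk_comb {l Ns : ℕ} (b : Fin Ns) (σ : SpinIdx l) (ε : FIdx2 l Ns) :
    blk b (comb b σ ε) = σ := by
  funext β; simp [blk, comb]

lemma blk_comb_ne {l Ns : ℕ} {b b' : Fin Ns} (h : b' ≠ b) (σ : SpinIdx l) (ε : FIdx2 l Ns) :
    blk b' (comb b σ ε) = blk b' ε := by
  funext β; simp [blk, comb, h]

lemma comb_blk {l Ns : ℕ} (b : Fin Ns) (ε : FIdx2 l Ns) : comb b (blk b ε) ε = ε := by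
  funext ⟨b', β⟩
  by_cases h : b' = b
  · subst h; simp [blk, comb]
  · simp [comb, h]

lemma vecMul_embed {l Ns : ℕ} (b : Fin Ns) (Mx : SpinOp l) (v : FIdx2 l Ns → ℂ)
    (ε : FIdx2 l Ns) :
    (v ᵥ* embed b Mx) ε = ∑ σ, v (comb b σ ε) * Mx σ (blk b ε) := by
  simp only [Matrix.vecMul, dotProduct]
  symm
  refine Fintype.sum_of_injective (fun σ : SpinIdx l => comb b σ ε) ?_ _ _ ?_ ?_
  · intro σ σ' h
    have := congrArg (blk b) h
    simpa [blk_comb] using this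
  · intro ε' hε'
    simp only [embed, Matrix.of_apply]
    rw [if_neg, mul_zero]
    intro h
    apply hε'
    refine ⟨blk b ε', ?_⟩
    funext ⟨b', β⟩
    by_cases hb : b' = b
    · subst hb; simp [blk, comb]
    · simp [comb, hb, h (b', β) hb]
  · intro σ
    simp only [embed, Matrix.of_apply]
    rw [if_pos]
    · have : (fun β => comb b σ ε (b, β)) = σ := blk_comb b σ ε
      rw [this]; rfl
    · intro s hs
      simp [comb, hs]

lemma fw_comb (q : ℂ) {l Ns : ℕ} (b : Fin Ns) (σ : SpinIdx l) (ε : FIdx2 l Ns) :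
    fw q (comb b σ ε) = bw q σ * ∏ b' ∈ Finset.univ.erase b, bw q (blk b' ε) := by
  unfold fw
  rw [← Finset.mul_prod_erase _ _ (Finset.mem_univ b), blk_comb]
  congr 1
  refine Finset.prod_congr rfl fun b' hb' => ?_
  rw [blk_comb_ne (Finset.ne_of_mem_erase hb')]

lemma comb_update_same {l Ns : ℕ} (b : Fin Ns) (k : Fin l) (x : Fin 2) (σ : SpinIdx l)
    (ε : FIdx2 l Ns) : comb b σ (update ε (b, k) x) = comb b σ ε := by
  funext ⟨b', β⟩
  by_cases h : b' = b
  · simp [comb, h]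
  · simp [comb, h]

lemma comb_update_ne {l Ns : ℕ} {b b' : Fin Ns} (h : b' ≠ b) (k : Fin l) (x : Fin 2)
    (σ : SpinIdx l) (ε : FIdx2 l Ns) :
    comb b σ (update ε (b', k) x) = update (comb b σ ε) (b', k) x := by
  funext ⟨b'', β⟩
  by_cases h1 : b'' = b
  · subst h1; simp [comb, h.symm]
  · by_cases h2 : (b'', β) = (b', k)
    · rw [h2]; simp [comb, h]
    · simp [comb, h1, update_of_ne h2]

lemma cv_swap {q : ℂ} (hq : q ≠ 0) {l j : ℕ} (k k' : Fin l) (hk : k'.val = k.val + 1)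
    (σ : SpinIdx l) (h0 : σ k = 0) (h1 : σ k' = 1) :
    cv q l j σ = q * cv q l j (update (update σ k 1) k' 0) := by
  have hne : k ≠ k' := by intro h; rw [h] at hk; omega
  rw [cv_apply, cv_apply, hv_bw, hv_bw, dcount_swap k k' hne σ h0 h1, bw_swap hq k k' hk σ h0 h1]
  split_ifs
  · ring
  · ring

lemma vecMul_E (q : ℂ) {l Ns : ℕ} (b : Fin Ns) (κ : ℂ) (i j : ℕ) (v : FIdx2 l Ns → ℂ)
    (ε : FIdx2 l Ns) :
    (v ᵥ* embed b (κ • rankOne (hv q l i) (cv q l j))) ε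
      = κ * cv q l j (blk b ε) * ∑ σ, v (comb b σ ε) * hv q l i σ := by
  rw [vecMul_embed, Finset.mul_sum]
  refine Finset.sum_congr rfl fun σ _ => ?_
  simp only [Matrix.smul_apply, rankOne, Matrix.of_apply, smul_eq_mul]
  ring

lemma SymV.E {q : ℂ} (hq : q ≠ 0) {l Ns : ℕ} {v : FIdx2 l Ns → ℂ} (h : SymV q v)
    (b : Fin Ns) (κ : ℂ) (i j : ℕ) :
    SymV q (v ᵥ* embed b (κ • rankOne (hv q l i) (cv q l j))) := by
  intro b' k k' hk ε h0 h1
  rw [vecMul_E, vecMul_E]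
  by_cases hb : b' = b
  · subst hb
    simp only [comb_update_same, blk_update_same]
    rw [cv_swap hq k k' hk (blk b' ε) h0 h1]
    ring
  · simp only [comb_update_ne hb, blk_update_ne (Ne.symm hb)]
    have : ∀ σ, v (comb b σ ε) =
        q * v (update (update (comb b σ ε) (b', k) 1) (b', k') 0) := by
      intro σ
      exact h b' k k' hk _ (by simp [comb, hb, h0]) (by simp [comb, hb, h1])
    simp only [this, mul_assoc, ← Finset.mul_sum]
    ring

lemma SymV.sum_hv {q : ℂ} (hq : q ≠ 0) {l Ns : ℕ}
    (hroot : ∀ m : ℕ, 1 ≤ m → m ≤ l → q ^ (2 * m) ≠ 1) {v : FIdx2 l Ns → ℂ} (h : SymV q v)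
    (b : Fin Ns) (A : Finset (Fin l)) (ε : FIdx2 l Ns) :
    ∑ σ, v (comb b σ ε) * hv q l A.card σ
      = v (comb b (indFun A) ε) * (bw q (indFun A))⁻¹ * Fnorm q l A.card := by
  have hA : A.card ≤ l := by simpa using Finset.card_le_univ A
  have hdA : dcount (indFun A) = A.card := by rw [dcount_supp, supp_indFun]
  rw [← sum_bw_sq hq hroot A.card hA, Finset.mul_sum]
  refine Finset.sum_congr rfl fun σ _ => ?_
  rw [hv_bw]
  split_ifs with hσ
  · have hr := h.ratio hq (comb b σ ε) (comb b (indFun A) ε) (by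
      intro b'
      by_cases hb : b' = b
      · subst hb; rw [blk_comb, blk_comb, hσ, hdA]
      · rw [blk_comb_ne hb, blk_comb_ne hb])
    rw [fw_comb, fw_comb] at hr
    have hR : ∏ b' ∈ Finset.univ.erase b, bw q (blk b' ε) ≠ 0 :=
      Finset.prod_ne_zero_iff.2 fun _ _ => bw_ne hq _
    have h1 := bw_ne hq σ
    have h2 := bw_ne hq (indFun A)
    field_simp at hr ⊢
    linear_combination hr
  · simp

lemma vecMul_projProd {q : ℂ} (hq : q ≠ 0) {l Ns : ℕ}
    (hroot : ∀ m : ℕ, 1 ≤ m → m ≤ l → q ^ (2 * m) ≠ 1) (N : ℕ) :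
    ∀ (X : Fin N → FOp l Ns) (_ : ∀ α (v : FIdx2 l Ns → ℂ), SymV q v → SymV q (v ᵥ* X α))
      (v : FIdx2 l Ns → ℂ), SymV q v →
      v ᵥ* (List.ofFn fun α => projFull q l Ns * X α * projFull q l Ns).prod
          = v ᵥ* (List.ofFn X).prod ∧ SymV q (v ᵥ* (List.ofFn X).prod) := by
  induction N with
  | zero => intro X _ v hv; simpa using hv
  | succ N ih =>
    intro X hX v hv
    have h1 := hX 0 v hv
    have h2 := ih (fun α => X α.succ) (fun α => hX α.succ) _ h1
    simp only [List.ofFn_succ, List.prod_cons, ← Matrix.vecMul_vecMul]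
    rw [hv.projFull hq hroot, h1.projFull hq hroot]
    exact h2

lemma prinProd {n : Type*} [Fintype n] [DecidableEq n] (G G' : Matrix n n ℂ)
    (hG : G * G' = 1) (hG' : G' * G = 1) (N : ℕ) : ∀ (x : Fin N → ℂ) (X : Fin N → Matrix n n ℂ),
    (List.ofFn fun α => Complex.exp (x α) • (G' * X α * G)).prod
      = Complex.exp (∑ α, x α) • (G' * (List.ofFn X).prod * G) := by
  induction N with
  | zero => intro x X; simp [hG']
  | succ N ih =>
    intro x X
    simp only [List.ofFn_succ, List.prod_cons, Fin.sum_univ_succ]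
    rw [ih (fun α => x α.succ) (fun α => X α.succ), Matrix.smul_mul, Matrix.mul_smul, smul_smul,
      Complex.exp_add]
    congr 1
    simp only [Matrix.mul_assoc]
    rw [← Matrix.mul_assoc G G', hG, Matrix.one_mul]

/-- diagonal entries of the gauge matrix -/
def dg {S : Type*} [Fintype S] (w : S → ℂ) (ε : S → Fin 2) : ℂ :=
  ∏ s, if ε s = 1 then Complex.exp (w s) else 1

lemma dg_ne {S : Type*} [Fintype S] (w : S → ℂ) (ε : S → Fin 2) : dg w ε ≠ 0 := by
  refine Finset.prod_ne_zero_iff.2 fun s _ => ?_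
  split_ifs
  · exact Complex.exp_ne_zero _
  · exact one_ne_zero

lemma gaugeM_eq {S : Type*} [Fintype S] [DecidableEq S] (w : S → ℂ) :
    gaugeM w = Matrix.diagonal (dg w) := rfl

lemma gaugeM_inv {S : Type*} [Fintype S] [DecidableEq S] (w : S → ℂ) :
    (gaugeM w)⁻¹ = Matrix.diagonal fun ε => (dg w ε)⁻¹ := by
  apply Matrix.inv_eq_left_inv
  rw [gaugeM_eq, Matrix.diagonal_mul_diagonal]
  simp [dg_ne]

lemma dg_comb {l Ns : ℕ} (w : FSite l Ns → ℂ) (b : Fin Ns) (σ : SpinIdx l) (ε : FIdx2 l Ns) :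
    dg w (comb b σ ε) = dg (fun β => w (b, β)) σ *
      ∏ b' ∈ Finset.univ.erase b, dg (fun β => w (b', β)) (blk b' ε) := by
  unfold dg
  rw [Fintype.prod_prod_type, ← Finset.mul_prod_erase _ _ (Finset.mem_univ b)]
  congr 1
  · simp [comb]
  · refine Finset.prod_congr rfl fun b' hb' => ?_
    simp [comb, Finset.ne_of_mem_erase hb', blk]
    try congr!

lemma dg_ratio {l Ns : ℕ} (w : FSite l Ns → ℂ) (b : Fin Ns) (σ : SpinIdx l) (ε : FIdx2 l Ns) :
    dg w (comb b σ ε) * (dg w ε)⁻¹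
      = dg (fun β => w (b, β)) σ * (dg (fun β => w (b, β)) (blk b ε))⁻¹ := by
  have h := dg_comb w b (blk b ε) ε
  rw [comb_blk] at h
  rw [h, dg_comb]
  have h1 : ∏ b' ∈ Finset.univ.erase b, dg (fun β => w (b', β)) (blk b' ε) ≠ 0 :=
    Finset.prod_ne_zero_iff.2 fun _ _ => dg_ne _ _
  have h2 := dg_ne (fun β => w (b, β)) (blk b ε)
  field_simp

lemma dg_string {l : ℕ} (x η : ℂ) (σ : SpinIdx l) :
    dg (fun β : Fin l => x - (β.val : ℂ) * η) σ
      = Complex.exp ((dcount σ : ℂ) * (x + η) - ((siteSum (supp σ) : ℤ) : ℂ) * η) := by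
  unfold dg
  rw [← Finset.prod_filter, ← Complex.exp_sum]
  congr 1
  change ∑ a ∈ supp σ, (x - (a.val : ℂ) * η) = _
  rw [dcount_supp]
  unfold siteSum
  push_cast
  rw [Finset.sum_mul, Finset.card_eq_sum_ones]
  push_cast
  rw [Finset.sum_mul, ← Finset.sum_sub_distrib]
  refine Finset.sum_congr rfl fun a _ => ?_
  ring

lemma bw_exp (η : ℂ) {l : ℕ} (σ : SpinIdx l) :
    bw (Complex.exp η) σ = Complex.exp ((((siteSum (supp σ) : ℤ) : ℂ) - (dcount σ : ℂ) * l
      + (dcount σ : ℂ) * ((dcount σ : ℂ) - 1) / 2) * η) := by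
  unfold bw hwt
  rw [← Complex.exp_int_mul]
  congr 2
  have : (dcount σ : ℤ) * ((dcount σ : ℤ) - 1) / 2 * 2 = dcount σ * (dcount σ - 1) :=
    Int.ediv_mul_cancel (Int.even_mul_pred_self _).two_dvd
  have h2 := congrArg (fun z : ℤ => (z : ℂ)) this
  generalize (dcount σ : ℤ) * ((dcount σ : ℤ) - 1) / 2 = t at *
  push_cast at h2 ⊢
  linear_combination h2 / 2

lemma vecMul_gauge_E {l Ns : ℕ} (w : FSite l Ns → ℂ) (b : Fin Ns) (A B : Finset (Fin l))
    (v : FIdx2 l Ns → ℂ) (ε : FIdx2 l Ns) :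
    (v ᵥ* (gaugeM w * embed b (rankOne (bvec A) (bvec B)) * (gaugeM w)⁻¹)) ε
      = v (comb b (indFun A) ε) * (dg w (comb b (indFun A) ε) * (dg w ε)⁻¹) *
        (if blk b ε = indFun B then 1 else 0) := by
  rw [gaugeM_inv, gaugeM_eq, ← Matrix.vecMul_vecMul, ← Matrix.vecMul_vecMul,
    Matrix.vecMul_diagonal, vecMul_embed]
  simp only [Matrix.vecMul_diagonal, rankOne, Matrix.of_apply, bvec]
  rw [Finset.sum_eq_single (indFun A)]
  · simp only [if_true]; ring
  · intro σ _ hσ; simp [hσ]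
  · simp

lemma vecMul_gauge_sum {l Ns : ℕ} (w : FSite l Ns → ℂ) (b : Fin Ns) (A : Finset (Fin l)) (j : ℕ)
    (v : FIdx2 l Ns → ℂ) (ε : FIdx2 l Ns) :
    (v ᵥ* ∑ B ∈ Finset.powersetCard j (Finset.univ : Finset (Fin l)),
      (gaugeM w * embed b (rankOne (bvec A) (bvec B)) * (gaugeM w)⁻¹)) ε
      = v (comb b (indFun A) ε) * (dg (fun β => w (b, β)) (indFun A) *
        (dg (fun β => w (b, β)) (blk b ε))⁻¹) *
        (if dcount (blk b ε) = j then 1 else 0) := by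
  rw [Matrix.vecMul_sum, Finset.sum_apply]
  simp only [vecMul_gauge_E, dg_ratio]
  rw [← Finset.mul_sum]
  congr 1
  have h : ∀ B : Finset (Fin l), blk b ε = indFun B ↔ B = supp (blk b ε) := by
    intro B
    constructor
    · intro h; rw [h, supp_indFun]
    · rintro rfl; exact (indFun_supp _).symm
  simp only [h, dcount_supp]
  rw [Finset.sum_ite_eq']
  simp [Finset.mem_powersetCard]
  try congr

end helpers4

/-- Reduction of the spin-`ℓ/2` off-shell matrix element of the general
elementary operator `Ê₁^{i,j(ℓ+)}` to a sum of spin-1/2 matrix elements: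
`⟨1_∅| ∏_α C^{(ℓ+)}(μ_α) Ê₁^{i,j(ℓ+)} ∏_β B^{(ℓ+)}(λ_β) |1_∅⟩
 = N̂_{i,j} e^{Σμ−Σλ} Σ_{|B|=j}
   ⟨1_∅| ∏_α C^{(ℓp;0)}(μ_α) (|1_A⟩⟨1_B| on block 1) ∏_β B^{(ℓp;0)}(λ_β) |1_∅⟩`,
for every fixed `A` with `|A| = i`. -/
theorem matrix_element_reduction (ℓ Ns : ℕ) (hl : 1 ≤ ℓ) (hNs : 0 < Ns)
    (η : ℂ) (ξ : Fin Ns → ℂ)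
    (hroot : ∀ m : ℕ, 1 ≤ m → m ≤ ℓ → Complex.exp η ^ (2 * m) ≠ 1)
    (g : ℕ → ℂ) (hg : ∀ n, n ≤ ℓ → g n ≠ 0)
    (i j : ℕ) (hi1 : 1 ≤ i) (hil : i ≤ ℓ) (hj1 : 1 ≤ j) (hjl : j ≤ ℓ)
    (N M : ℕ) (hbal : (i : ℤ) - (j : ℤ) = (N : ℤ) - (M : ℤ))
    (μ : Fin N → ℂ) (lam : Fin M → ℂ)
    (hdμ : ∀ (α : Fin N) (s : FSite ℓ Ns),
      Complex.sinh (μ α - wstring ℓ Ns η ξ s + η) ≠ 0)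
    (hdlam : ∀ (β : Fin M) (s : FSite ℓ Ns),
      Complex.sinh (lam β - wstring ℓ Ns η ξ s + η) ≠ 0)
    (A : Finset (Fin ℓ)) (hA : A.card = i) :
    ((List.ofFn fun α : Fin N => Cproj ℓ Ns η ξ (μ α)).prod *
        embed (⟨0, hNs⟩ : Fin Ns)
          (((g j / g i) *
              Complex.exp (((i : ℂ) - (j : ℂ)) * (ξ ⟨0, hNs⟩ - ((ℓ : ℂ) - 1) * η / 2))) •
            rankOne (hv (Complex.exp η) ℓ i) (cv (Complex.exp η) ℓ j)) *
        (List.ofFn fun β : Fin M => Bproj ℓ Ns η ξ (lam β)).prod)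
        (vac ℓ Ns) (vac ℓ Ns)
      = Nhat (Complex.exp η) η g ℓ i j *
          Complex.exp ((∑ α, μ α) - (∑ β, lam β)) *
          ∑ B ∈ Finset.powersetCard j (Finset.univ : Finset (Fin ℓ)),
            ((List.ofFn fun α : Fin N => Cprin ℓ Ns η ξ (μ α)).prod *
              embed (⟨0, hNs⟩ : Fin Ns) (rankOne (bvec A) (bvec B)) *
              (List.ofFn fun β : Fin M => Bprin ℓ Ns η ξ (lam β)).prod)
              (vac ℓ Ns) (vac ℓ Ns) := by
  classical
  set q := Complex.exp η with hqdef
  have hq : q ≠ 0 := Complex.exp_ne_zero _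
  set b0 : Fin Ns := ⟨0, hNs⟩ with hb0
  set w := wstring ℓ Ns η ξ with hw
  set κ := (g j / g i) *
    Complex.exp (((i : ℂ) - (j : ℂ)) * (ξ b0 - ((ℓ : ℂ) - 1) * η / 2)) with hκ
  let e0 : FIdx2 ℓ Ns → ℂ := Pi.single (vac ℓ Ns) 1
  have he0 : ∀ X : FOp ℓ Ns, X (vac ℓ Ns) (vac ℓ Ns) = (Matrix.vecMul e0 X) (vac ℓ Ns) := by
    intro X; simp [e0]
  have hs0 : SymV q e0 := by
    intro b k k' hk ε h0 h1
    have hne : ((b, k) : FSite ℓ Ns) ≠ (b, k') := by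
      intro h; have := congrArg (fun x => x.2.val) h; simp at this; omega
    have n1 : ε ≠ vac ℓ Ns := by
      rintro rfl; simp [vac] at h1
    have n2 : Function.update (Function.update ε (b, k) 1) (b, k') 0 ≠ vac ℓ Ns := by
      intro h; have := congrFun h (b, k); simp [vac, hne] at this
    simp [e0, n1, n2]
  have hC := vecMul_projProd hq hroot N (fun α => Cop0 ℓ Ns η ξ (μ α))
    (fun α v hv => hv.entry ξ (μ α) (hdμ α) 1 0) e0 hs0
  set Cm := (List.ofFn fun α => Cop0 ℓ Ns η ξ (μ α)).prod with hCm
  set Bm := (List.ofFn fun β => Bop0 ℓ Ns η ξ (lam β)).prod with hBm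
  have hB := vecMul_projProd hq hroot M (fun β => Bop0 ℓ Ns η ξ (lam β))
    (fun β v hv => hv.entry ξ (lam β) (hdlam β) 0 1) _ (hC.2.E hq b0 κ i j)
  have hGG' : gaugeM w * (gaugeM w)⁻¹ = 1 := by
    rw [gaugeM_inv, gaugeM_eq, Matrix.diagonal_mul_diagonal]; simp [dg_ne]
  have hG'G : (gaugeM w)⁻¹ * gaugeM w = 1 := by
    rw [gaugeM_inv, gaugeM_eq, Matrix.diagonal_mul_diagonal]; simp [dg_ne]
  have hCp : (List.ofFn fun α : Fin N => Cprin ℓ Ns η ξ (μ α)).prod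
      = Complex.exp (∑ α, -μ α) • ((gaugeM w)⁻¹ * Cm * gaugeM w) :=
    prinProd _ _ hGG' hG'G N (fun α => -μ α) _
  have hBp : (List.ofFn fun β : Fin M => Bprin ℓ Ns η ξ (lam β)).prod
      = Complex.exp (∑ β, lam β) • ((gaugeM w)⁻¹ * Bm * gaugeM w) :=
    prinProd _ _ hGG' hG'G M lam _
  have hdv : dg w (vac ℓ Ns) = 1 := by simp [dg, vac]
  have hR : ∀ B : Finset (Fin ℓ), ((List.ofFn fun α : Fin N => Cprin ℓ Ns η ξ (μ α)).prod *
              embed b0 (rankOne (bvec A) (bvec B)) *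
              (List.ofFn fun β : Fin M => Bprin ℓ Ns η ξ (lam β)).prod)
              (vac ℓ Ns) (vac ℓ Ns)
      = Complex.exp (-((∑ α, μ α) - (∑ β, lam β))) *
        (Cm * (gaugeM w * embed b0 (rankOne (bvec A) (bvec B)) * (gaugeM w)⁻¹) * Bm)
          (vac ℓ Ns) (vac ℓ Ns) := by
    intro B
    rw [hCp, hBp, Matrix.smul_mul, Matrix.smul_mul, Matrix.mul_smul, smul_smul,
      ← Complex.exp_add, Matrix.smul_apply, smul_eq_mul]
    congr 1
    · congr 1; rw [Finset.sum_neg_distrib]; ring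
    · have e : (gaugeM w)⁻¹ * Cm * gaugeM w * embed b0 (rankOne (bvec A) (bvec B)) *
          ((gaugeM w)⁻¹ * Bm * gaugeM w) = (gaugeM w)⁻¹ * (Cm * (gaugeM w *
            embed b0 (rankOne (bvec A) (bvec B)) * (gaugeM w)⁻¹) * Bm) * gaugeM w := by
        simp only [Matrix.mul_assoc]
      rw [e]
      generalize Cm * (gaugeM w *
            embed b0 (rankOne (bvec A) (bvec B)) * (gaugeM w)⁻¹) * Bm = X
      rw [gaugeM_inv, gaugeM_eq, Matrix.mul_diagonal, Matrix.diagonal_mul, hdv]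
      simp
  rw [Finset.sum_congr rfl fun B _ => hR B, ← Finset.mul_sum, ← Matrix.sum_apply,
    ← Finset.sum_mul, ← Finset.mul_sum, mul_assoc (Nhat _ _ _ _ _ _),
    ← mul_assoc (Complex.exp ((∑ α, μ α) - (∑ β, lam β))),
    ← Complex.exp_add, add_neg_cancel, Complex.exp_zero, one_mul]
  refine (he0 _).trans (Eq.trans ?_ (congrArg (Nhat q η g ℓ i j * ·) (he0 _).symm))
  beta_reduce
  rw [← Matrix.vecMul_vecMul, ← Matrix.vecMul_vecMul, ← Matrix.vecMul_vecMul,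
    ← Matrix.vecMul_vecMul]
  have hL1 : Matrix.vecMul e0 (List.ofFn fun α : Fin N => Cproj ℓ Ns η ξ (μ α)).prod
      = Matrix.vecMul e0 Cm := hC.1
  rw [hL1]
  refine (congrFun hB.1 (vac ℓ Ns)).trans ?_
  rw [← smul_eq_mul]
  refine Eq.trans ?_ (congrFun (Matrix.smul_vecMul (Nhat q η g ℓ i j) _ Bm) (vac ℓ Ns))
  refine congrFun (congrArg (fun v => Matrix.vecMul v Bm) ?_) (vac ℓ Ns)
  funext ε
  rw [Pi.smul_apply, smul_eq_mul, vecMul_gauge_sum, vecMul_E, cv_apply, hv_bw, ← hA,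
    hC.2.sum_hv hq hroot]
  by_cases hj : dcount (blk b0 ε) = j
  · rw [if_pos hj, if_pos hj, mul_one, hA]
    have hdA : dcount (indFun A) = i := by rw [dcount_supp, supp_indFun, hA]
    have hfun : (fun β => w (b0, β)) = fun β : Fin ℓ => ξ b0 - (β.val : ℂ) * η := rfl
    have hsc : Complex.exp (((i : ℂ) - (j : ℂ)) * (ξ b0 - ((ℓ : ℂ) - 1) * η / 2)) *
        bw q (blk b0 ε) * (bw q (indFun A))⁻¹
        = Complex.exp (η * (((i : ℂ) * ((ℓ : ℂ) - (i : ℂ)) - (j : ℂ) * ((ℓ : ℂ) - (j : ℂ))) / 2)) *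
          (dg (fun β => w (b0, β)) (indFun A) * (dg (fun β => w (b0, β)) (blk b0 ε))⁻¹) := by
      rw [hfun, dg_string, dg_string, hqdef, bw_exp, bw_exp, hj, hdA, ← Complex.exp_neg,
        ← Complex.exp_neg, ← Complex.exp_add, ← Complex.exp_add, ← Complex.exp_add,
        ← Complex.exp_add]
      congr 1
      ring
    unfold Nhat
    rw [hκ]
    linear_combination (g j / g i * (Fnorm q ℓ j)⁻¹ * Fnorm q ℓ i *
      (Matrix.vecMul e0 Cm) (comb b0 (indFun A) ε)) * hsc
  · simp [hj]
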